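/- Let ε > 0 and λ ∈ ℝ. Let u_p be a 2π-periodic solution of (∗) on ℝ with u_p(π/2) = 0, u_p'(0) = u_p'(π) = 0, and u_p'(t) > 0 for all t ∈ (0, π). If u is any 2π-periodic solution of (∗) on ℝ with u'(0) = u'(π) = 0 and u(0) < u_p(0), then u(t) < u_p(t) for all t ∈ ℝ. -/

import Mathlib

open Real Set

/-- `u` is a solution of the forced Duffing equation
`ε²·u'' = u³ − λ·u + cos t` on all of `ℝ`. -/
def IsDuffingSol (ε lam : ℝ) (u : ℝ → ℝ) : Prop :=
  ContDiff ℝ 2 u ∧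
  ∀ t : ℝ, ε ^ 2 * deriv (deriv u) t = u t ^ 3 - lam * u t + Real.cos t

open Filter Topology

/-- A differentiable function that is positive at `a` and nonpositive at `b > a` has a first zero,
where its derivative is nonpositive. -/
lemma exists_first_zero {f f' : ℝ → ℝ} (hf : ∀ t, HasDerivAt f (f' t) t) {a b : ℝ} (hab : a ≤ b)
    (ha : 0 < f a) (hb : f b ≤ 0) :
    ∃ c ∈ Ioc a b, f c = 0 ∧ f' c ≤ 0 ∧ ∀ t ∈ Ico a c, 0 < f t := by
  have hcont : Continuous f := continuous_iff_continuousAt.2 fun t => (hf t).continuousAt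
  have hcpt : IsCompact (Icc a b ∩ f ⁻¹' Iic 0) :=
    isCompact_Icc.inter_right (isClosed_Iic.preimage hcont)
  obtain ⟨c, ⟨hcab, hc0⟩, hleast⟩ := hcpt.exists_isLeast ⟨b, ⟨hab, le_rfl⟩, hb⟩
  have hpos : ∀ t ∈ Ico a c, 0 < f t := by
    intro t ht
    by_contra! h
    exact absurd (hleast ⟨⟨ht.1, ht.2.le.trans hcab.2⟩, h⟩) (not_le.2 ht.2)
  obtain ⟨x, hx, hfx⟩ := intermediate_value_Icc' hcab.1 hcont.continuousOn ⟨hc0, ha.le⟩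
  have hxc : x = c := le_antisymm hx.2 (hleast ⟨⟨hx.1, hx.2.trans hcab.2⟩, hfx.le⟩)
  rw [hxc] at hfx
  have hac : a < c := lt_of_le_of_ne hcab.1 (by rintro rfl; exact ha.ne' hfx)
  refine ⟨c, ⟨hac, hcab.2⟩, hfx, ?_, hpos⟩
  have hslope := (hasDerivWithinAt_iff_tendsto_slope' (self_notMem_Iio)).1
    ((hf c).hasDerivWithinAt (s := Iio c))
  refine le_of_tendsto hslope ?_
  filter_upwards [Ico_mem_nhdsLT hac] with t ht
  rw [slope_def_field, hfx]
  exact div_nonpos_of_nonneg_of_nonpos (by linarith [hpos t ht]) (by linarith [ht.2])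

namespace IsDuffingSol

variable {ε lam : ℝ} {u v : ℝ → ℝ}

lemma hasDerivAt (hu : IsDuffingSol ε lam u) (t : ℝ) : HasDerivAt u (deriv u t) t :=
  (hu.1.differentiable (by norm_num) t).hasDerivAt

lemma hasDerivAt_deriv (hu : IsDuffingSol ε lam u) (t : ℝ) :
    HasDerivAt (deriv u) (deriv (deriv u) t) t := by
  have h : ContDiff ℝ 1 (deriv u) := ((contDiff_succ_iff_deriv (n := 1)).1 hu.1).2.2
  exact (h.differentiable (by norm_num) t).hasDerivAt

lemma hasDerivAt_deriv_deriv (hε : 0 < ε) (hu : IsDuffingSol ε lam u) (t : ℝ) :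
    HasDerivAt (deriv (deriv u))
      (((3 * u t ^ 2 - lam) * deriv u t - Real.sin t) / ε ^ 2) t := by
  have heq : deriv (deriv u) = fun t => (u t ^ 3 - lam * u t + Real.cos t) / ε ^ 2 := by
    funext s
    rw [eq_div_iff (by positivity), ← hu.2 s, mul_comm]
  rw [heq]
  refine (((((hu.hasDerivAt t).pow 3).sub ((hu.hasDerivAt t).const_mul lam)).add
    (Real.hasDerivAt_cos t)).div_const (ε ^ 2)).congr_deriv ?_
  push_cast
  ring

lemma of_deriv (hu : ∀ t, HasDerivAt u (v t) t)
    (hv : ∀ t, HasDerivAt v ((u t ^ 3 - lam * u t + Real.cos t) / ε ^ 2) t) (hε : 0 < ε) :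
    IsDuffingSol ε lam u := by
  have h1 : deriv u = v := funext fun t => (hu t).deriv
  have h2 : deriv v = fun t => (u t ^ 3 - lam * u t + Real.cos t) / ε ^ 2 :=
    funext fun t => (hv t).deriv
  have hd : Differentiable ℝ u := fun t => (hu t).differentiableAt
  have huc : Continuous u := hd.continuous
  have hv1 : ContDiff ℝ 1 v := by
    rw [contDiff_one_iff_deriv, h2]
    exact ⟨fun t => (hv t).differentiableAt, by fun_prop⟩
  refine ⟨?_, fun t => ?_⟩
  · refine (contDiff_succ_iff_deriv (n := 1)).2 ⟨hd, by simp, ?_⟩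
    rwa [h1]
  · rw [h1, h2]
    field_simp

lemma hasDerivAt_deriv' (hε : 0 < ε) (hu : IsDuffingSol ε lam u) (t : ℝ) :
    HasDerivAt (deriv u) ((u t ^ 3 - lam * u t + Real.cos t) / ε ^ 2) t := by
  convert hu.hasDerivAt_deriv t using 1
  rw [← hu.2 t]
  field_simp

/-- The equation is invariant under `t ↦ -t`. -/
lemma comp_neg (hε : 0 < ε) (hu : IsDuffingSol ε lam u) :
    IsDuffingSol ε lam (fun t => u (-t)) := by
  refine of_deriv (v := fun t => -deriv u (-t)) (fun t => ?_) (fun t => ?_) hε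
  · exact ((hu.hasDerivAt (-t)).comp t (hasDerivAt_neg t)).congr_deriv (by simp)
  · exact ((hu.hasDerivAt_deriv' hε (-t)).comp t (hasDerivAt_neg t)).neg.congr_deriv (by simp)

lemma hasDerivAt_neg_comp_pi_sub (hu : IsDuffingSol ε lam u) (t : ℝ) :
    HasDerivAt (fun t => -u (π - t)) (deriv u (π - t)) t := by
  exact ((hu.hasDerivAt (π - t)).comp t ((hasDerivAt_id t).const_sub π)).neg.congr_deriv (by simp)

/-- The equation is invariant under `u ↦ -u(π - ·)`. -/
lemma neg_comp_pi_sub (hε : 0 < ε) (hu : IsDuffingSol ε lam u) :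
    IsDuffingSol ε lam (fun t => -u (π - t)) := by
  refine of_deriv (v := fun t => deriv u (π - t)) hu.hasDerivAt_neg_comp_pi_sub (fun t => ?_) hε
  refine ((hu.hasDerivAt_deriv' hε (π - t)).comp t
    ((hasDerivAt_id t).const_sub π)).congr_deriv ?_
  rw [Real.cos_pi_sub]
  ring

/-- Uniqueness for the initial value problem. -/
lemma eq_of_initial (hε : 0 < ε) (hu : IsDuffingSol ε lam u) (hv : IsDuffingSol ε lam v) {s : ℝ}
    (h0 : u s = v s) (h1 : deriv u s = deriv v s) : u = v := by
  have huc : Continuous u := hu.1.continuous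
  have hvc : Continuous v := hv.1.continuous
  set q : ℝ → ℝ := fun t => (u t ^ 2 + u t * v t + v t ^ 2 - lam) / ε ^ 2 with hq
  have hqc : Continuous q := by fun_prop
  funext t
  set R : ℝ := |s| + |t| + 1
  obtain ⟨K, hK⟩ := isCompact_Icc.exists_bound_of_continuousOn (s := Icc (-R) R) hqc.continuousOn
  have hmem : ∀ x : ℝ, |x| < R → x ∈ Ioo (-R) R := fun x hx => abs_lt.1 hx
  have hs := hmem s (by linarith [abs_nonneg t])
  have ht := hmem t (by linarith [abs_nonneg s])
  have hlip : ∀ x ∈ Ioo (-R) R,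
      LipschitzOnWith (max 1 K.toNNReal) (fun p : ℝ × ℝ => (p.2, q x * p.1)) univ := by
    intro x hx
    have hqK : ‖q x‖₊ ≤ K.toNNReal := by
      rw [← NNReal.coe_le_coe, coe_nnnorm]
      exact (hK x ⟨hx.1.le, hx.2.le⟩).trans (Real.le_coe_toNNReal K)
    have hfst : LipschitzWith K.toNNReal (fun p : ℝ × ℝ => q x * p.1) := by
      have h := ((lipschitzWith_smul (q x)).weaken hqK).comp
        (LipschitzWith.prod_fst (α := ℝ) (β := ℝ))
      simpa [Function.comp_def] using h
    exact (LipschitzWith.prod_snd.prodMk hfst).lipschitzOnWith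
  have hE := ODE_solution_unique_of_mem_Ioo
    (v := fun x (p : ℝ × ℝ) => (p.2, q x * p.1)) (s := fun _ => univ)
    (f := fun x => (u x - v x, deriv u x - deriv v x)) (g := fun _ => (0, 0)) hlip hs
    (fun x _ => ⟨?_, mem_univ _⟩) (fun x _ => ⟨?_, mem_univ _⟩) (by simp [h0, h1])
  · have := hE ht
    simp only [Prod.mk.injEq] at this
    linarith [this.1]
  · refine ((hu.hasDerivAt x).sub (hv.hasDerivAt x)).prodMk ?_
    refine ((hu.hasDerivAt_deriv' hε x).sub (hv.hasDerivAt_deriv' hε x)).congr_deriv ?_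
    simp only [hq]
    ring
  · exact (hasDerivAt_const x ((0 : ℝ), (0 : ℝ))).congr_deriv (by simp [Prod.zero_eq_mk])

/-- Comparison on the first half period, where the larger solution is nonpositive: the Wronskian
of `v - u` and `v` is strictly decreasing as long as `u < v`. -/
lemma lt_on_half (hε : 0 < ε) (hv : IsDuffingSol ε lam v) (hu : IsDuffingSol ε lam u)
    (hv0 : deriv v 0 = 0) (hu0 : deriv u 0 = 0) (hneg : ∀ t ∈ Icc 0 (π / 2), v t ≤ 0)
    (hlt : u 0 < v 0) : ∀ t ∈ Icc 0 (π / 2), u t < v t := by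
  intro s hs
  by_contra! hle
  obtain ⟨c, hc, hfc, hdc, hpos⟩ := exists_first_zero
    (fun t => (hv.hasDerivAt t).sub (hu.hasDerivAt t)) hs.1
    (sub_pos.2 hlt) (sub_nonpos.2 hle)
  simp only [Pi.sub_apply] at hfc hdc hpos
  have hW : ∀ t, HasDerivAt
      (fun t => (deriv v t - deriv u t) * v t - (v t - u t) * deriv v t)
      ((v t - u t) * (u t * v t * (u t + v t) - Real.cos t) / ε ^ 2) t := by
    intro t
    refine ((((hv.hasDerivAt_deriv' hε t).sub (hu.hasDerivAt_deriv' hε t)).mul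
      (hv.hasDerivAt t)).sub (((hv.hasDerivAt t).sub (hu.hasDerivAt t)).mul
      (hv.hasDerivAt_deriv' hε t))).congr_deriv ?_
    simp only [Pi.sub_apply]
    field_simp
    ring
  have hanti := strictAntiOn_of_deriv_neg (convex_Icc 0 c)
    (fun t _ => (hW t).continuousAt.continuousWithinAt) (by
      intro t ht
      rw [interior_Icc] at ht
      rw [(hW t).deriv]
      have hw := hpos t ⟨ht.1.le, ht.2⟩
      have hv' := hneg t ⟨ht.1.le, by linarith [ht.2, hc.2, hs.2]⟩
      have hcos : 0 < Real.cos t :=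
        Real.cos_pos_of_mem_Ioo ⟨by linarith [ht.1, Real.pi_pos], by linarith [ht.2, hc.2, hs.2]⟩
      have huv : 0 ≤ u t * v t := mul_nonneg_of_nonpos_of_nonpos (by linarith) hv'
      have hbr : u t * v t * (u t + v t) ≤ 0 :=
        mul_nonpos_of_nonneg_of_nonpos huv (by linarith)
      exact div_neg_of_neg_of_pos (mul_neg_of_pos_of_neg hw (by linarith)) (by positivity))
  have hlt' := hanti ⟨le_rfl, hc.1.le⟩ ⟨hc.1.le, le_rfl⟩ hc.1
  simp only [hv0, hu0, hfc] at hlt'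
  have := mul_nonneg_of_nonpos_of_nonpos hdc (hneg c ⟨hc.1.le, hc.2.trans hs.2⟩)
  linarith

/-- If `v` is positive and increasing on `(a, b)`, then `u > v` cannot hold on `(a, b)` with
equality at both ends: the Wronskian of `v - u` and `v'` would be strictly decreasing. -/
lemma not_bump (hε : 0 < ε) (hv : IsDuffingSol ε lam v) (hu : IsDuffingSol ε lam u)
    {a b : ℝ} (hab : a < b) (ha : 0 ≤ a) (hb : b ≤ π)
    (hva : 0 ≤ deriv v a) (hvb : 0 ≤ deriv v b) (hmono : ∀ t ∈ Ioo a b, 0 < deriv v t)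
    (hpos : ∀ t ∈ Ioo a b, 0 < v t) (hlt : ∀ t ∈ Ioo a b, v t < u t)
    (hwa : v a - u a = 0) (hwb : v b - u b = 0)
    (hda : deriv v a - deriv u a ≤ 0) (hdb : 0 ≤ deriv v b - deriv u b) : False := by
  have hW : ∀ t, HasDerivAt
      (fun t => (deriv v t - deriv u t) * deriv v t - (v t - u t) * deriv (deriv v) t)
      ((-((v t - u t) ^ 2 * deriv v t * (u t + 2 * v t)) + (v t - u t) * Real.sin t) / ε ^ 2)
      t := by
    intro t
    refine ((((hv.hasDerivAt_deriv' hε t).sub (hu.hasDerivAt_deriv' hε t)).mul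
      (hv.hasDerivAt_deriv' hε t)).sub (((hv.hasDerivAt t).sub (hu.hasDerivAt t)).mul
      (hv.hasDerivAt_deriv_deriv hε t))).congr_deriv ?_
    have h2 := (hv.hasDerivAt_deriv' hε t).deriv
    simp only [Pi.sub_apply, h2]
    field_simp
    ring
  have hanti := strictAntiOn_of_deriv_neg (convex_Icc a b)
    (fun t _ => (hW t).continuousAt.continuousWithinAt) (by
      intro t ht
      rw [interior_Icc] at ht
      rw [(hW t).deriv]
      have hw := hlt t ht
      have hvt := hpos t ht
      have hdt := hmono t ht
      have hsin : 0 < Real.sin t :=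
        Real.sin_pos_of_pos_of_lt_pi (ha.trans_lt ht.1) (ht.2.trans_le hb)
      have h1 : 0 ≤ (v t - u t) ^ 2 * deriv v t * (u t + 2 * v t) :=
        mul_nonneg (mul_nonneg (sq_nonneg _) hdt.le) (by linarith)
      have h2 : (v t - u t) * Real.sin t < 0 := mul_neg_of_neg_of_pos (by linarith) hsin
      exact div_neg_of_neg_of_pos (by linarith) (by positivity))
  have hlt' := hanti ⟨le_rfl, hab.le⟩ ⟨hab.le, le_rfl⟩ hab
  simp only [hwa, hwb] at hlt'
  have h1 := mul_nonpos_of_nonpos_of_nonneg hda hva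
  have h2 := mul_nonneg hdb hvb
  linarith

end IsDuffingSol

/-- If `u_p` is a `2π`-periodic solution with `u_p(π/2) = 0`,
`u_p'(0) = u_p'(π) = 0` and `u_p' > 0` on `(0,π)`, and `u` is any `2π`-periodic
solution with `u'(0) = u'(π) = 0` and `u(0) < u_p(0)`, then `u < u_p` everywhere. -/
theorem stmt_6 (ε lam : ℝ) (hε : 0 < ε) (up u : ℝ → ℝ)
    (hpsol : IsDuffingSol ε lam up)
    (hpper : Function.Periodic up (2 * π))
    (hpz : up (π / 2) = 0)
    (hp0 : deriv up 0 = 0) (hppi : deriv up π = 0)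
    (hpmono : ∀ t ∈ Ioo (0 : ℝ) π, 0 < deriv up t)
    (husol : IsDuffingSol ε lam u)
    (huper : Function.Periodic u (2 * π))
    (hu0 : deriv u 0 = 0) (hupi : deriv u π = 0)
    (hlt : u 0 < up 0) :
    ∀ t : ℝ, u t < up t := by
  have hpi := Real.pi_pos
  have hpd : ∀ t ∈ Icc (0 : ℝ) π, 0 ≤ deriv up t := by
    intro t ht
    rcases ht.1.eq_or_lt with rfl | h0
    · exact hp0.ge
    rcases ht.2.eq_or_lt with rfl | h1
    · exact hppi.ge
    exact (hpmono t ⟨h0, h1⟩).le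
  have hstrict : StrictMonoOn up (Icc 0 π) :=
    strictMonoOn_of_deriv_pos (convex_Icc 0 π) hpsol.1.continuous.continuousOn
      (by rwa [interior_Icc])
  have hmid : π / 2 ∈ Icc 0 π := ⟨by linarith, by linarith⟩
  have hneg : ∀ t ∈ Icc 0 (π / 2), up t ≤ 0 := fun t ht =>
    hpz ▸ hstrict.monotoneOn ⟨ht.1, by linarith [ht.2]⟩ hmid ht.2
  have hposp : ∀ t ∈ Ioc (π / 2) π, 0 < up t := fun t ht =>
    hpz ▸ hstrict hmid ⟨by linarith [ht.1], ht.2⟩ ht.1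
  have hnonneg : ∀ t ∈ Icc (π / 2) π, 0 ≤ up t := fun t ht =>
    hpz ▸ hstrict.monotoneOn hmid ⟨by linarith [ht.1], ht.2⟩ ht.1
  have hne : ∀ s, u s = up s → deriv u s ≠ deriv up s := fun s h h' =>
    hlt.ne (congrFun (husol.eq_of_initial hε hpsol h h') 0)
  have hfirst := hpsol.lt_on_half hε husol hp0 hu0 hneg hlt
  have hend : u π < up π := by
    rcases lt_trichotomy (u π) (up π) with h | h | h
    · exact h
    · exact absurd (hupi.trans hppi.symm) (hne π h)
    · have hrefl := (hpsol.neg_comp_pi_sub hε).lt_on_half hε (husol.neg_comp_pi_sub hε)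
        (by rw [(hpsol.hasDerivAt_neg_comp_pi_sub 0).deriv, sub_zero, hppi])
        (by rw [(husol.hasDerivAt_neg_comp_pi_sub 0).deriv, sub_zero, hupi])
        (fun t ht => neg_nonpos.2 (hnonneg _ ⟨by linarith [ht.2], by linarith [ht.1]⟩))
        (by simpa using h) (π / 2) ⟨by linarith, le_rfl⟩
      have h1 := hfirst (π / 2) ⟨by linarith, le_rfl⟩
      simp only [sub_half] at hrefl
      linarith
  have hwd : ∀ t, HasDerivAt (fun t => up t - u t) (deriv up t - deriv u t) t := fun t =>
    (hpsol.hasDerivAt t).sub (husol.hasDerivAt t)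
  have hle : ∀ t ∈ Icc (π / 2) π, u t ≤ up t := by
    intro s hs
    by_contra! h
    obtain ⟨b, hb, hwb, hdb, hbpos⟩ := exists_first_zero (fun t => (hwd t).neg) hs.2
      (by simpa using h) (by simpa using hend.le)
    obtain ⟨a, ha, hwa, hda, hapos⟩ := exists_first_zero
      (f := fun t => -(up (-t) - u (-t))) (f' := fun t => deriv up (-t) - deriv u (-t))
      (a := -s) (b := -(π / 2))
      (fun t => ((hwd (-t)).comp t (hasDerivAt_neg t)).neg.congr_deriv (by simp))
      (by linarith [hs.1]) (by simpa using h)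
      (by simpa using (hfirst (π / 2) ⟨by linarith, le_rfl⟩).le)
    simp only [Pi.neg_apply] at hwb hdb hbpos
    have has : -a < s := by linarith [ha.1]
    have hpa : π / 2 ≤ -a := by linarith [ha.2]
    refine hpsol.not_bump hε husol (a := -a) (b := b) (has.trans hb.1) (by linarith) hb.2
      (hpd _ ⟨by linarith, by linarith [hs.2]⟩) (hpd _ ⟨by linarith [hb.1], hb.2⟩)
      (fun t ht => hpmono t ⟨by linarith [ht.1], by linarith [ht.2, hb.2]⟩)
      (fun t ht => hposp t ⟨by linarith [ht.1], by linarith [ht.2, hb.2]⟩)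
      (fun t ht => ?_) (by linarith) (by linarith) hda (by linarith)
    rcases le_total s t with hst | hst
    · linarith [hbpos t ⟨hst, ht.2⟩]
    · have := hapos (-t) ⟨by linarith, by linarith [ht.1]⟩
      rw [neg_neg] at this
      linarith
  have hhalf : ∀ t ∈ Icc 0 π, u t < up t := by
    intro t ht
    rcases le_or_gt t (π / 2) with h | h
    · exact hfirst t ⟨ht.1, h⟩
    refine lt_of_le_of_ne (hle t ⟨h.le, ht.2⟩) fun heq => ?_
    have htpi : t < π := lt_of_le_of_ne ht.2 (by rintro rfl; exact hend.ne heq)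
    have hmin : IsLocalMin (fun t => up t - u t) t := by
      filter_upwards [Ioo_mem_nhds h htpi] with x hx
      linarith [hle x ⟨hx.1.le, hx.2.le⟩]
    exact hne t heq (by linarith [hmin.hasDerivAt_eq_zero (hwd t)])
  have heven : ∀ {f : ℝ → ℝ}, IsDuffingSol ε lam f → deriv f 0 = 0 → ∀ t, f (-t) = f t := by
    intro f hf hf0
    refine congrFun ((hf.comp_neg hε).eq_of_initial hε hf (s := 0) (by simp) ?_)
    rw [deriv_comp_neg, neg_zero, hf0, neg_zero]
  intro t
  obtain ⟨y, hy, hty⟩ := (hpper.sub huper).exists_mem_Ico (by linarith) t (-π)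
  simp only [Pi.sub_apply] at hty
  suffices u y < up y by linarith
  rcases le_total 0 y with h | h
  · exact hhalf y ⟨h, by linarith [hy.2]⟩
  · rw [← heven husol hu0, ← heven hpsol hp0]
    exact hhalf (-y) ⟨by linarith, by linarith [hy.1]⟩
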